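/- Existence of a boundary limit at the south pole: let κ > 0 and let F be twice differentiable on (0,π) and solve the hedgehog Skyrme ODE on (0,π). Then F(ψ) tends to a finite limit as ψ → π⁻. -/

import Mathlib

open Real Set Filter Topology

/-- The hedgehog Skyrme ODE on the three-sphere with coupling constant `κ`:
`(sin²ψ + κ²·sin²F)·F'' + sin(2ψ)·F' + (κ²/2)·sin(2F)·F'² − sin(2F)
  − (κ²/2)·(sin²F/sin²ψ)·sin(2F) = 0` on `(0, π)`. -/
def SkyrmeEq (κ : ℝ) (F : ℝ → ℝ) : Prop :=
  ∀ ψ ∈ Set.Ioo (0:ℝ) Real.pi,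
    (Real.sin ψ ^ 2 + κ ^ 2 * Real.sin (F ψ) ^ 2) * deriv (deriv F) ψ
      + Real.sin (2 * ψ) * deriv F ψ
      + κ ^ 2 / 2 * Real.sin (2 * F ψ) * deriv F ψ ^ 2
      - Real.sin (2 * F ψ)
      - κ ^ 2 / 2 * (Real.sin (F ψ) ^ 2 / Real.sin ψ ^ 2) * Real.sin (2 * F ψ) = 0

/-- `F` is twice differentiable on `(0, π)`. -/
def TwiceDiffOnIoo (F : ℝ → ℝ) : Prop :=
  ∀ ψ ∈ Set.Ioo (0:ℝ) Real.pi,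
    DifferentiableAt ℝ F ψ ∧ DifferentiableAt ℝ (deriv F) ψ

/-- A Lyapunov function of the hedgehog Skyrme equation: it decreases on `[π/2, π)`. -/
noncomputable def skyrmeEnergy (κ : ℝ) (F : ℝ → ℝ) (ψ : ℝ) : ℝ :=
  1 / 2 * (sin ψ ^ 2 + κ ^ 2 * sin (F ψ) ^ 2) * (sin ψ * deriv F ψ) ^ 2
    + sin ψ ^ 2 * cos (F ψ) ^ 2 - κ ^ 2 / 4 * sin (F ψ) ^ 4

theorem hasDerivAt_skyrmeEnergy {κ : ℝ} {F : ℝ → ℝ} (hF : TwiceDiffOnIoo F)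
    (hode : SkyrmeEq κ F) {ψ : ℝ} (hψ : ψ ∈ Ioo 0 π) :
    HasDerivAt (skyrmeEnergy κ F)
      (sin ψ * cos ψ * (κ ^ 2 * sin (F ψ) ^ 2 * deriv F ψ ^ 2 + 2 * cos (F ψ) ^ 2)) ψ := by
  have hF1 := (hF ψ hψ).1.hasDerivAt
  have hF2 := (hF ψ hψ).2.hasDerivAt
  have hs : sin ψ ≠ 0 := (sin_pos_of_mem_Ioo hψ).ne'
  have hS := hF1.sin
  have hC := hF1.cos
  have hs1 := hasDerivAt_sin ψ
  have h := (((((hs1.pow 2).add ((hS.pow 2).const_mul (κ ^ 2))).const_mul (1 / 2)).mul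
    ((hs1.mul hF2).pow 2)).add ((hs1.pow 2).mul (hC.pow 2))).sub
    ((hS.pow 4).const_mul (κ ^ 2 / 4))
  refine h.congr_deriv ?_
  have e := hode ψ hψ
  rw [sin_two_mul, sin_two_mul] at e
  field_simp at e
  simp only [Pi.add_apply, Pi.mul_apply, Pi.pow_apply]
  push_cast
  linear_combination (deriv F ψ) * e

theorem skyrmeEnergy_add_nonneg (κ : ℝ) (F : ℝ → ℝ) (ψ : ℝ) :
    0 ≤ skyrmeEnergy κ F ψ + κ ^ 2 / 4 * sin (F ψ) ^ 4 := by
  have : skyrmeEnergy κ F ψ + κ ^ 2 / 4 * sin (F ψ) ^ 4 =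
      1 / 2 * (sin ψ ^ 2 + κ ^ 2 * sin (F ψ) ^ 2) * (sin ψ * deriv F ψ) ^ 2
        + sin ψ ^ 2 * cos (F ψ) ^ 2 := by unfold skyrmeEnergy; ring
  rw [this]; positivity

theorem neg_le_skyrmeEnergy (κ : ℝ) (F : ℝ → ℝ) (ψ : ℝ) :
    -(κ ^ 2 / 4) ≤ skyrmeEnergy κ F ψ := by
  have h := skyrmeEnergy_add_nonneg κ F ψ
  have h1 : sin (F ψ) ^ 4 ≤ 1 := by
    have := sin_sq_le_one (F ψ)
    nlinarith [sq_nonneg (sin (F ψ))]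
  nlinarith [mul_le_mul_of_nonneg_left h1 (by positivity : 0 ≤ κ ^ 2 / 4)]

theorem antitoneOn_skyrmeEnergy {κ : ℝ} {F : ℝ → ℝ} (hF : TwiceDiffOnIoo F)
    (hode : SkyrmeEq κ F) : AntitoneOn (skyrmeEnergy κ F) (Ico (π / 2) π) := by
  have hmem : ∀ ψ ∈ Ico (π / 2) π, ψ ∈ Ioo 0 π := fun ψ h =>
    ⟨(by positivity : (0 : ℝ) < π / 2).trans_le h.1, h.2⟩
  refine antitoneOn_of_hasDerivWithinAt_nonpos (convex_Ico _ _)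
    (fun ψ h => (hasDerivAt_skyrmeEnergy hF hode (hmem ψ h)).continuousAt.continuousWithinAt)
    (fun ψ h => (hasDerivAt_skyrmeEnergy hF hode
      (hmem ψ (interior_subset h))).hasDerivWithinAt) fun ψ h => ?_
  have h' := interior_subset h
  have hs := sin_pos_of_mem_Ioo (hmem ψ h')
  have hc : cos ψ ≤ 0 := cos_nonpos_of_pi_div_two_le_of_le h'.1 (by linarith [h'.2, pi_pos])
  exact mul_nonpos_of_nonpos_of_nonneg (mul_nonpos_of_nonneg_of_nonpos hs.le hc) (by positivity)

/-- The weight whose integral along a solution is controlled by the energy loss. -/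
noncomputable def skyrmeWeight (κ E y : ℝ) : ℝ :=
  sin y ^ 4 * max 0 (E + κ ^ 2 / 4 * sin y ^ 4)

theorem continuous_skyrmeWeight (κ E : ℝ) : Continuous (skyrmeWeight κ E) := by
  unfold skyrmeWeight; fun_prop

theorem skyrmeWeight_nonneg (κ E y : ℝ) : 0 ≤ skyrmeWeight κ E y := by
  unfold skyrmeWeight; positivity

/-- The purely algebraic estimate behind `exists_skyrmeWeight_mul_abs_deriv_le`. -/
theorem weight_mul_le_of_energy {κ s S C D M P : ℝ} (hκ : 0 < κ) (hs : 0 < s)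
    (hs1 : s ≤ 1) (hS1 : |S| ≤ 1) (hM : |S * (s * D)| ≤ M)
    (hP : P ≤ 1 / 2 * (s ^ 2 + κ ^ 2 * S ^ 2) * (s * D) ^ 2 + s ^ 2 * C ^ 2) :
    S ^ 4 * P * |D| ≤
      M * (1 + (1 + κ ^ 2) / κ ^ 2) * (s * (κ ^ 2 * S ^ 2 * D ^ 2 + 2 * C ^ 2)) := by
  have hM0 : 0 ≤ M := (abs_nonneg _).trans hM
  have hS2 : S ^ 2 ≤ 1 := (sq_le_one_iff_abs_le_one S).2 hS1
  have hs2 : s ^ 2 ≤ 1 := by nlinarith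
  have hM' : |S| * (s * |D|) ≤ M := by rwa [abs_mul, abs_mul, abs_of_pos hs] at hM
  have hP' : P ≤ (1 + κ ^ 2) * (s * D) ^ 2 + s ^ 2 * C ^ 2 := by
    have h1 : 1 / 2 * (s ^ 2 + κ ^ 2 * S ^ 2) ≤ 1 + κ ^ 2 := by
      nlinarith [mul_le_mul_of_nonneg_left hS2 (sq_nonneg κ), sq_nonneg κ]
    nlinarith [mul_le_mul_of_nonneg_right h1 (sq_nonneg (s * D))]
  refine le_of_mul_le_mul_left ?_ hs
  have e4 : S ^ 4 = |S| * (|S| * S ^ 2) := by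
    rw [← mul_assoc, abs_mul_abs_self]; ring
  have hSS : |S| * S ^ 2 ≤ S ^ 2 := mul_le_of_le_one_left (sq_nonneg _) hS1
  have hSS1 : |S| * S ^ 2 ≤ 1 := hSS.trans hS2
  calc s * (S ^ 4 * P * |D|) = |S| * (s * |D|) * (|S| * S ^ 2 * P) := by rw [e4]; ring
    _ ≤ |S| * (s * |D|) * (|S| * S ^ 2 * ((1 + κ ^ 2) * (s * D) ^ 2 + s ^ 2 * C ^ 2)) := by
        gcongr
    _ ≤ M * (|S| * S ^ 2 * ((1 + κ ^ 2) * (s * D) ^ 2 + s ^ 2 * C ^ 2)) := by gcongr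
    _ = M * (|S| * S ^ 2 * ((1 + κ ^ 2) * (s * D) ^ 2) + |S| * S ^ 2 * (s ^ 2 * C ^ 2)) := by
        ring
    _ ≤ M * (S ^ 2 * ((1 + κ ^ 2) * (s * D) ^ 2) + 1 * (s ^ 2 * C ^ 2)) := by gcongr
    _ ≤ M * (S ^ 2 * ((1 + κ ^ 2) * (s * D) ^ 2) + 1 * (s ^ 2 * C ^ 2)) +
        M * (κ ^ 2 * S ^ 2 * (s * D) ^ 2 + s ^ 2 * C ^ 2 +
          2 * ((1 + κ ^ 2) / κ ^ 2) * (s ^ 2 * C ^ 2)) :=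
        le_add_of_nonneg_right (by positivity)
    _ = s * (M * (1 + (1 + κ ^ 2) / κ ^ 2) *
        (s * (κ ^ 2 * S ^ 2 * D ^ 2 + 2 * C ^ 2))) := by
        field_simp
        ring

theorem exists_skyrmeWeight_mul_abs_deriv_le {κ : ℝ} (hκ : 0 < κ) {F : ℝ → ℝ}
    (hF : TwiceDiffOnIoo F) (hode : SkyrmeEq κ F) {E : ℝ}
    (hE : ∀ ψ ∈ Ico (π / 2) π, E ≤ skyrmeEnergy κ F ψ) :
    ∃ K : ℝ, 0 ≤ K ∧ ∀ ψ ∈ Ico (2 * π / 3) π, skyrmeWeight κ E (F ψ) * |deriv F ψ| ≤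
      K * -(sin ψ * cos ψ *
        (κ ^ 2 * sin (F ψ) ^ 2 * deriv F ψ ^ 2 + 2 * cos (F ψ) ^ 2)) := by
  set M := √(2 * (skyrmeEnergy κ F (π / 2) + κ ^ 2 / 4) / κ ^ 2)
  refine ⟨2 * (M * (1 + (1 + κ ^ 2) / κ ^ 2)), by positivity, fun ψ hψ => ?_⟩
  have hψ' : ψ ∈ Ico (π / 2) π := ⟨by linarith [hψ.1, pi_pos], hψ.2⟩
  have hs : 0 < sin ψ := sin_pos_of_mem_Ioo ⟨by linarith [hψ.1, pi_pos], hψ.2⟩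
  have hc : cos ψ ≤ -(1 / 2) := by
    have h := cos_le_cos_of_nonneg_of_le_pi (by positivity) hψ.2.le hψ.1
    have : cos (2 * π / 3) = -(1 / 2) := by
      rw [show 2 * π / 3 = π - π / 3 by ring, cos_pi_sub, cos_pi_div_three]
    linarith
  have hEψ : skyrmeEnergy κ F ψ ≤ skyrmeEnergy κ F (π / 2) :=
    antitoneOn_skyrmeEnergy hF hode ⟨le_rfl, by linarith [pi_pos]⟩ hψ' hψ'.1
  have hS4 : sin (F ψ) ^ 4 ≤ 1 := by
    have := sin_sq_le_one (F ψ)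
    nlinarith [sq_nonneg (sin (F ψ))]
  have hM : |sin (F ψ) * (sin ψ * deriv F ψ)| ≤ M := by
    refine abs_le_sqrt ?_
    rw [le_div_iff₀ (by positivity)]
    have h1 : skyrmeEnergy κ F ψ =
      1 / 2 * κ ^ 2 * (sin (F ψ) * (sin ψ * deriv F ψ)) ^ 2 +
        (1 / 2 * sin ψ ^ 2 * (sin ψ * deriv F ψ) ^ 2 + sin ψ ^ 2 * cos (F ψ) ^ 2)
        - κ ^ 2 / 4 * sin (F ψ) ^ 4 := by unfold skyrmeEnergy; ring
    have h2 : 0 ≤ 1 / 2 * sin ψ ^ 2 * (sin ψ * deriv F ψ) ^ 2 + sin ψ ^ 2 * cos (F ψ) ^ 2 := by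
      positivity
    have h3 := mul_le_mul_of_nonneg_left hS4 (by positivity : 0 ≤ κ ^ 2 / 4)
    linarith
  have hP : max 0 (E + κ ^ 2 / 4 * sin (F ψ) ^ 4) ≤
      1 / 2 * (sin ψ ^ 2 + κ ^ 2 * sin (F ψ) ^ 2) * (sin ψ * deriv F ψ) ^ 2
        + sin ψ ^ 2 * cos (F ψ) ^ 2 := by
    refine max_le (by positivity) ?_
    have := hE ψ hψ'
    unfold skyrmeEnergy at this
    linarith
  have key := weight_mul_le_of_energy hκ hs (sin_le_one ψ) (abs_sin_le_one (F ψ)) hM hP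
  refine key.trans ?_
  have hX : 0 ≤ M * (1 + (1 + κ ^ 2) / κ ^ 2) * (sin ψ *
    (κ ^ 2 * sin (F ψ) ^ 2 * deriv F ψ ^ 2 + 2 * cos (F ψ) ^ 2)) := by positivity
  nlinarith [mul_nonneg hX (by linarith : 0 ≤ -(1 / 2) - cos ψ)]

/-- A function antitone and bounded below to the left of `b` converges at `b⁻`. -/
theorem AntitoneOn.exists_tendsto_nhdsLT {f : ℝ → ℝ} {a b m : ℝ} (hab : a < b)
    (hf : AntitoneOn f (Ico a b)) (hm : ∀ x ∈ Ico a b, m ≤ f x) :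
    ∃ l, Tendsto f (𝓝[<] b) (𝓝 l) ∧ ∀ x ∈ Ico a b, l ≤ f x := by
  have hbdd : BddBelow (f '' Ioo a b) := by
    refine ⟨m, ?_⟩
    rintro _ ⟨x, hx, rfl⟩
    exact hm x (Ioo_subset_Ico_self hx)
  have ht := (hf.mono Ioo_subset_Ico_self).tendsto_nhdsWithin_Ioo_left (nonempty_Ioo.2 hab) hbdd
  refine ⟨_, ht, fun x hx => le_of_tendsto ht ?_⟩
  filter_upwards [Ioo_mem_nhdsLT hx.2] with y hy
  exact hf hx ⟨hx.1.trans hy.1.le, hy.2⟩ hy.1.le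

/-- If `|g'| ≤ -K f'` near `b⁻` and `f` is bounded below, then `g` converges at `b⁻`. -/
theorem exists_tendsto_of_abs_deriv_le {f f' g g' : ℝ → ℝ} {a b m l K : ℝ} (hab : a < b)
    (hK : 0 ≤ K) (hf : ∀ x ∈ Ico a b, HasDerivAt f (f' x) x)
    (hg : ∀ x ∈ Ico a b, HasDerivAt g (g' x) x)
    (h : ∀ x ∈ Ico a b, |g' x| ≤ K * -f' x) (hm : ∀ x ∈ Ico a b, m ≤ f x)
    (hl : Tendsto f (𝓝[<] b) (𝓝 l)) : ∃ L, Tendsto g (𝓝[<] b) (𝓝 L) := by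
  have anti : ∀ u u' : ℝ → ℝ, (∀ x ∈ Ico a b, HasDerivAt u (u' x) x) →
      (∀ x ∈ Ico a b, u' x ≤ 0) → AntitoneOn u (Ico a b) := fun u u' hu hu' =>
    antitoneOn_of_hasDerivWithinAt_nonpos (convex_Ico _ _)
      (fun x hx => (hu x hx).continuousAt.continuousWithinAt)
      (fun x hx => (hu x (interior_subset hx)).hasDerivWithinAt)
      fun x hx => hu' x (interior_subset hx)
  have h1 : AntitoneOn (fun x => K * f x + g x) (Ico a b) :=
    anti _ _ (fun x hx => ((hf x hx).const_mul K).add (hg x hx))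
      fun x hx => by linarith [h x hx, le_abs_self (g' x)]
  have h2 : AntitoneOn (fun x => K * f x - g x) (Ico a b) :=
    anti _ _ (fun x hx => ((hf x hx).const_mul K).sub (hg x hx))
      fun x hx => by linarith [h x hx, neg_abs_le (g' x)]
  obtain ⟨L, hL, -⟩ := AntitoneOn.exists_tendsto_nhdsLT
    (m := K * m + (K * m - (K * f a - g a))) hab h1 fun x hx => by
      have h3 := h2 ⟨le_rfl, hab⟩ hx hx.1
      have h4 := mul_le_mul_of_nonneg_left (hm x hx) hK
      simp only at h3
      linarith
  refine ⟨L - K * l, (hL.sub (hl.const_mul K)).congr fun x => by ring⟩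

/-- A continuous function taking values below and above `y` arbitrarily close to `b⁻` takes the
value `y` arbitrarily close to `b⁻`. -/
theorem frequently_eq_of_frequently_lt_of_frequently_gt {f : ℝ → ℝ} {a b y : ℝ} (hab : a < b)
    (hf : ContinuousOn f (Ioo a b)) (h1 : ∃ᶠ x in 𝓝[<] b, f x < y)
    (h2 : ∃ᶠ x in 𝓝[<] b, y < f x) : ∃ᶠ x in 𝓝[<] b, f x = y := by
  intro hne
  obtain ⟨c, hc, hcb⟩ := (mem_nhdsLT_iff_exists_Ioo_subset' hab).1
    (inter_mem hne (Ioo_mem_nhdsLT hab))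
  obtain ⟨x1, hx1, hx1'⟩ := (h1.and_eventually (Ioo_mem_nhdsLT hc)).exists
  obtain ⟨x2, hx2, hx2'⟩ := (h2.and_eventually (Ioo_mem_nhdsLT hc)).exists
  obtain ⟨z, hz, hzy⟩ := isPreconnected_Ioo.intermediate_value hx1' hx2'
    (hf.mono fun x hx => (hcb hx).2) ⟨hx1.le, hx2.le⟩
  exact (hcb hz).1 hzy

/-- A continuous function that is unbounded near `b⁻` meets the multiples of `π` arbitrarily close
to `b⁻`. -/
theorem frequently_sin_eq_zero_of_unbounded {f : ℝ → ℝ} {a b : ℝ} (hab : a < b)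
    (hf : ContinuousOn f (Ioo a b)) (h : ¬ ∃ R, ∀ᶠ x in 𝓝[<] b, |f x| ≤ R) :
    ∃ᶠ x in 𝓝[<] b, sin (f x) = 0 := by
  intro hne
  obtain ⟨c, hc, hcb⟩ := (mem_nhdsLT_iff_exists_Ioo_subset' hab).1
    (inter_mem hne (Ioo_mem_nhdsLT hab))
  obtain ⟨x0, hx0⟩ := nonempty_Ioo.2 (mem_Iio.1 hc)
  refine h ⟨|f x0| + π, ?_⟩
  filter_upwards [Ioo_mem_nhdsLT hc] with x hx
  by_contra! hlt
  have hcont : ContinuousOn f (Ioo c b) := hf.mono fun x hx => (hcb hx).2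
  have key : ∀ k : ℤ, (k * π) ∉ f '' Ioo c b := by
    rintro k ⟨z, hz, hzk⟩
    exact (hcb hz).1 (by simp only [hzk, sin_int_mul_pi])
  rcases le_total 0 (f x) with h0 | h0
  · rw [abs_of_nonneg h0] at hlt
    refine key ⌊f x / π⌋ (isPreconnected_Ioo.intermediate_value hx0 hx hcont ⟨?_, ?_⟩)
    · have := Int.lt_floor_add_one (f x / π)
      rw [div_lt_iff₀ pi_pos] at this
      linarith [le_abs_self (f x0)]
    · exact (le_div_iff₀ pi_pos).1 (Int.floor_le _)
  · rw [abs_of_nonpos h0] at hlt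
    refine key ⌈f x / π⌉ (isPreconnected_Ioo.intermediate_value hx hx0 hcont ⟨?_, ?_⟩)
    · exact (div_le_iff₀ pi_pos).1 (Int.le_ceil _)
    · have := Int.ceil_lt_add_one (f x / π)
      rw [← sub_lt_iff_lt_add, lt_div_iff₀ pi_pos] at this
      linarith [neg_abs_le (f x0)]

/-- The primitive of the weight; it is monotone, and proper when `0 ≤ E`. -/
noncomputable def skyrmePrimitive (κ E y : ℝ) : ℝ := ∫ t in (0 : ℝ)..y, skyrmeWeight κ E t

theorem hasDerivAt_skyrmePrimitive (κ E y : ℝ) :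
    HasDerivAt (skyrmePrimitive κ E) (skyrmeWeight κ E y) y :=
  (continuous_skyrmeWeight κ E).integral_hasStrictDerivAt 0 y |>.hasDerivAt

theorem skyrmeWeight_periodic (κ E : ℝ) : Function.Periodic (skyrmeWeight κ E) (2 * π) := by
  intro y; simp only [skyrmeWeight, sin_add_two_pi]

theorem skyrmeWeight_integral_pos {κ E : ℝ} (hκ : 0 < κ) (hE : 0 ≤ E) :
    0 < ∫ t in (0 : ℝ)..(2 * π), skyrmeWeight κ E t := by
  refine intervalIntegral.integral_pos (by positivity)
    (continuous_skyrmeWeight κ E).continuousOn (fun y _ => skyrmeWeight_nonneg κ E y)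
    ⟨π / 2, ⟨by positivity, by linarith [pi_pos]⟩, ?_⟩
  simp only [skyrmeWeight, sin_pi_div_two, one_pow, one_mul, mul_one]
  exact lt_max_of_lt_right (by positivity)

theorem exists_abs_le_of_tendsto_skyrmePrimitive {κ E L : ℝ} (hκ : 0 < κ) (hE : 0 ≤ E)
    {F : ℝ → ℝ} {l : Filter ℝ}
    (h : Tendsto (fun ψ => skyrmePrimitive κ E (F ψ)) l (𝓝 L)) :
    ∃ R, ∀ᶠ ψ in l, |F ψ| ≤ R := by
  have hpos := skyrmeWeight_integral_pos hκ hE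
  have htop : Tendsto (skyrmePrimitive κ E) atTop atTop :=
    (skyrmeWeight_periodic κ E).tendsto_atTop_intervalIntegral_of_pos
      hpos (by positivity)
  have hbot : Tendsto (skyrmePrimitive κ E) atBot atBot :=
    (skyrmeWeight_periodic κ E).tendsto_atBot_intervalIntegral_of_pos
      hpos (by positivity)
  obtain ⟨A, hA⟩ := eventually_atTop.1 (htop.eventually_gt_atTop (L + 1))
  obtain ⟨B, hB⟩ := eventually_atBot.1 (hbot.eventually_lt_atBot (L - 1))
  refine ⟨max |A| |B|, ?_⟩
  filter_upwards [h.eventually_lt_const (by linarith : L < L + 1),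
    h.eventually_const_lt (by linarith : L - 1 < L)] with ψ h1 h2
  have hlt : F ψ < A := by
    by_contra! hc
    exact lt_asymm h1 (hA _ hc)
  have hgt : B < F ψ := by
    by_contra! hc
    exact lt_asymm h2 (hB _ hc)
  exact abs_le.2 ⟨by linarith [neg_abs_le B, le_max_right |A| |B|],
    by linarith [le_abs_self A, le_max_left |A| |B|]⟩

/-- The function `sin⁴ y (E + κ²/4 sin⁴ y)` does not vanish identically on any interval. -/
theorem exists_sin_pow_mul_ne_zero {κ : ℝ} (hκ : 0 < κ) (E : ℝ) {a b : ℝ} (hab : a < b) :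
    ∃ y ∈ Ioo a b, sin y ^ 4 * (E + κ ^ 2 / 4 * sin y ^ 4) ≠ 0 := by
  by_contra! h
  obtain ⟨c, hc⟩ := nonempty_Ioo.2 hab
  have han : AnalyticOnNhd ℝ (fun y : ℝ => sin y ^ 4 * (E + κ ^ 2 / 4 * sin y ^ 4)) univ :=
    fun y _ => by fun_prop
  have hz := han.eq_of_eventuallyEq (g := fun _ => 0) (fun y _ => analyticAt_const)
    (z₀ := c) (by filter_upwards [Ioo_mem_nhds hc.1 hc.2] with y hy using h y hy)
  have h1 := congrFun hz (π / 2)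
  have h2 := congrFun hz (π / 6)
  simp only [sin_pi_div_two, sin_pi_div_six] at h1 h2
  nlinarith [sq_pos_of_pos hκ]

/-- Existence of a boundary limit at the south pole: a solution `F` of the
hedgehog Skyrme ODE on `(0,π)` tends to a finite limit as `ψ → π⁻`. -/
theorem skyrme_limit_south_pole (κ : ℝ) (hκ : 0 < κ) (F : ℝ → ℝ)
    (hF : TwiceDiffOnIoo F) (hode : SkyrmeEq κ F) :
    ∃ a : ℝ, Filter.Tendsto F (nhdsWithin Real.pi (Set.Iio Real.pi)) (nhds a) := by
  have hcont : ContinuousOn F (Ioo 0 π) := fun ψ hψ =>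
    (hF ψ hψ).1.continuousAt.continuousWithinAt
  obtain ⟨E, hE, hEle⟩ := AntitoneOn.exists_tendsto_nhdsLT (by linarith [pi_pos])
    (antitoneOn_skyrmeEnergy hF hode) fun ψ _ => neg_le_skyrmeEnergy κ F ψ
  obtain ⟨K, hK, hKle⟩ := exists_skyrmeWeight_mul_abs_deriv_le hκ hF hode hEle
  have hmem : ∀ ψ ∈ Ico (2 * π / 3) π, ψ ∈ Ioo 0 π := fun ψ h =>
    ⟨by linarith [h.1, pi_pos], h.2⟩
  obtain ⟨L, hL⟩ : ∃ L, Tendsto (fun ψ => skyrmePrimitive κ E (F ψ)) (𝓝[<] π) (𝓝 L) := by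
    refine exists_tendsto_of_abs_deriv_le (by linarith [pi_pos]) hK
      (fun ψ h => hasDerivAt_skyrmeEnergy hF hode (hmem ψ h))
      (fun ψ h => (hasDerivAt_skyrmePrimitive κ E (F ψ)).comp ψ (hF ψ (hmem ψ h)).1.hasDerivAt)
      (fun ψ h => ?_) (fun ψ _ => neg_le_skyrmeEnergy κ F ψ) hE
    rw [abs_mul, abs_of_nonneg (skyrmeWeight_nonneg κ E _)]
    exact hKle ψ h
  have hfreq : ∀ v, (∃ᶠ ψ in 𝓝[<] π, sin (F ψ) = v) → 0 ≤ E + κ ^ 2 / 4 * v ^ 4 := by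
    intro v hv
    by_contra! hlt
    obtain ⟨ψ, h1, h2⟩ := (hv.and_eventually
      (hE.eventually_lt_const (by linarith : E < -(κ ^ 2 / 4 * v ^ 4)))).exists
    have := skyrmeEnergy_add_nonneg κ F ψ
    rw [h1] at this
    linarith
  obtain ⟨R, hR⟩ : ∃ R, ∀ᶠ ψ in 𝓝[<] π, |F ψ| ≤ R := by
    by_contra hunb
    have h0 := hfreq 0 (frequently_sin_eq_zero_of_unbounded pi_pos hcont hunb)
    exact hunb (exists_abs_le_of_tendsto_skyrmePrimitive hκ (by simpa using h0) hL)
  refine tendsto_of_no_upcrossings dense_univ ?_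
    ⟨R, eventually_map.2 (hR.mono fun ψ h => (abs_le.1 h).2)⟩
    ⟨-R, eventually_map.2 (hR.mono fun ψ h => (abs_le.1 h).1)⟩
  rintro a - b - hab ⟨ha, hb⟩
  have hhit : ∀ y ∈ Ioo a b, ∃ᶠ ψ in 𝓝[<] π, F ψ = y := fun y hy =>
    frequently_eq_of_frequently_lt_of_frequently_gt pi_pos hcont
      (ha.mono fun ψ h => h.trans hy.1) (hb.mono fun ψ h => hy.2.trans h)
  have hconst : ∀ y ∈ Ioo a b, skyrmePrimitive κ E y = L := by
    intro y hy
    by_contra hne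
    obtain ⟨ψ, h1, h2⟩ := ((hhit y hy).and_eventually (hL.eventually_ne (Ne.symm hne))).exists
    exact h2 (by rw [h1])
  obtain ⟨y, hy, hne⟩ := exists_sin_pow_mul_ne_zero hκ E hab
  have hw : skyrmeWeight κ E y = 0 := by
    refine (hasDerivAt_skyrmePrimitive κ E y).unique
      ((hasDerivAt_const y L).congr_of_eventuallyEq ?_)
    filter_upwards [Ioo_mem_nhds hy.1 hy.2] with z hz using hconst z hz
  rw [skyrmeWeight, max_eq_right (hfreq _ ((hhit y hy).mono fun ψ h => by rw [h]))] at hw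
  exact hne hw
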